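/- arXiv:math/0209170 — 10 statements merged into one kernel-verified Lean document; each statement's English description precedes it below -/
import Mathlib

section
/- A point τ ∈ (ℝ^k)* is a singular value of μ — i.e., there exists x ∈ ℂ^n with μ(x) = τ such that {w_ν : x_ν ≠ 0} does not span (ℝ^k)* — if and only if there exist a subset S ⊆ {1,…,n} with at most k − 1 elements and real numbers c_ν > 0 (ν ∈ S) such that τ = ∑_{ν∈S} c_ν w_ν. -/
open Real Finset

noncomputable section

/-- The weight vectors, viewed as real covectors on `ℝ^k`
(identifying `(ℝ^k)*` with `ℝ^k` via the standard basis; integrality of the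
functionals on `ℤ^k` amounts to integrality of the coordinates). -/
def wR {k n : ℕ} (w : Fin n → Fin k → ℤ) (ν : Fin n) : Fin k → ℝ :=
  fun i => (w ν i : ℝ)

/-- The moment map `μ(x) = π ∑_ν |x_ν|² w_ν`. -/
def momentMap {k n : ℕ} (w : Fin n → Fin k → ℤ) (x : Fin n → ℂ) : Fin k → ℝ :=
  ∑ ν, (π * ‖x ν‖ ^ 2) • wR w ν

theorem conic_carath {ι V : Type*} [DecidableEq ι] [AddCommGroup V] [Module ℝ V] (v : ι → V) :
    ∀ (m : ℕ) (S : Finset ι) (c : ι → ℝ), S.card = m → (∀ i ∈ S, 0 < c i) →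
      ∃ T ⊆ S, ∃ d : ι → ℝ, (∀ i ∈ T, 0 < d i) ∧ ∑ i ∈ T, d i • v i = ∑ i ∈ S, c i • v i ∧
        LinearIndepOn ℝ v (T : Set ι) := by
  intro m
  induction m using Nat.strong_induction_on with
  | _ m ih =>
    intro S c hm hc
    by_cases hli : LinearIndepOn ℝ v (S : Set ι)
    · exact ⟨S, Finset.Subset.refl _, c, hc, rfl, hli⟩
    have key : ∃ g : ι → ℝ, ∑ i ∈ S, g i • v i = 0 ∧ ∃ i ∈ S, 0 < g i := by
      rw [linearIndepOn_finset_iff] at hli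
      push Not at hli
      obtain ⟨g, hg, i, hi, hne⟩ := hli
      rcases lt_or_gt_of_ne hne with h | h
      · refine ⟨fun j => - g j, ?_, i, hi, by simpa using h⟩
        simp [neg_smul, hg]
      · exact ⟨g, hg, i, hi, h⟩
    obtain ⟨g, hg, i, hi, hgi⟩ := key
    obtain ⟨j, hj, hmin⟩ := Finset.exists_min_image (S.filter (fun i => 0 < g i))
      (fun i => c i / g i) ⟨i, by simp [hi, hgi]⟩
    rw [Finset.mem_filter] at hj
    obtain ⟨hjS, hgj⟩ := hj
    set r := c j / g j with hr
    have hrpos : 0 < r := div_pos (hc j hjS) hgj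
    let d : ι → ℝ := fun l => c l - r * g l
    have hd0 : ∀ l ∈ S, 0 ≤ d l := by
      intro l hl
      simp only [d]
      rcases lt_or_ge 0 (g l) with h | h
      · have := hmin l (by simp [hl, h])
        rw [le_div_iff₀ h] at this
        linarith
      · nlinarith [hc l hl]
    have hdj : d j = 0 := by
      simp only [d, hr]
      field_simp
      simp
    have hsum : ∑ l ∈ S, d l • v l = ∑ l ∈ S, c l • v l := by
      simp only [d, sub_smul, mul_smul, Finset.sum_sub_distrib, ← Finset.smul_sum, hg]
      simp
    have hsum2 : ∑ l ∈ S.filter (fun l => 0 < d l), d l • v l = ∑ l ∈ S, d l • v l := by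
      apply Finset.sum_subset (Finset.filter_subset _ _)
      intro l hl hl'
      have : d l = 0 := by
        have h1 := hd0 l hl
        have h2 : ¬ 0 < d l := fun h => hl' (by simp [hl, h])
        linarith
      simp [this]
    have hlt : (S.filter (fun l => 0 < d l)).card < m := by
      rw [← hm]
      apply Finset.card_lt_card
      rw [Finset.filter_ssubset]
      exact ⟨j, hjS, by simp [hdj]⟩
    obtain ⟨T, hT, e, he, hes, hTl⟩ := ih _ hlt (S.filter (fun l => 0 < d l)) d rfl
      (fun l hl => (Finset.mem_filter.1 hl).2)
    exact ⟨T, hT.trans (Finset.filter_subset _ _), e, he, by rw [hes, hsum2, hsum], hTl⟩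

/-- `τ` is a singular value of `μ` if and only if `τ` is a positive
linear combination of at most `k - 1` of the vectors `w_ν`. -/
theorem singular_value_iff_pos_comb_of_at_most_k_sub_one
    (k n : ℕ) (hk : 1 ≤ k) (hkn : k ≤ n)
    (w : Fin n → Fin k → ℤ)
    (hspan : Submodule.span ℝ (Set.range (wR w)) = ⊤)
    (τ : Fin k → ℝ) :
    (∃ x : Fin n → ℂ, momentMap w x = τ ∧
        Submodule.span ℝ (wR w '' {ν | x ν ≠ 0}) ≠ ⊤) ↔
      ∃ S : Finset (Fin n), S.card ≤ k - 1 ∧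
        ∃ c : Fin n → ℝ, (∀ ν ∈ S, 0 < c ν) ∧ τ = ∑ ν ∈ S, c ν • wR w ν := by
  classical
  constructor
  · rintro ⟨x, hx, hne⟩
    obtain ⟨T, hT, d, hd, hds, hli⟩ := conic_carath (wR w) _ (Finset.univ.filter (fun ν => x ν ≠ 0))
      (fun ν => π * ‖x ν‖ ^ 2) rfl (by
        intro i hi
        have : x i ≠ 0 := (Finset.mem_filter.1 hi).2
        have := norm_pos_iff.2 this
        have := Real.pi_pos
        positivity)
    refine ⟨T, ?_, d, hd, ?_⟩
    · have h1 := Submodule.finrank_lt hne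
      have h2 : Submodule.span ℝ (Set.range (fun i : (T : Set (Fin n)) => wR w i)) ≤
          Submodule.span ℝ (wR w '' {ν | x ν ≠ 0}) := by
        apply Submodule.span_mono
        rintro _ ⟨i, rfl⟩
        exact ⟨i, (Finset.mem_filter.1 (hT i.2)).2, rfl⟩
      have h3 := Submodule.finrank_mono h2
      have h4 := finrank_span_eq_card (R := ℝ) hli
      rw [h4] at h3
      simp at h1 h3
      omega
    · rw [hds, ← hx, momentMap]
      symm
      apply Finset.sum_subset (Finset.filter_subset _ _)
      intro l _ hl'
      have : x l = 0 := by simpa using hl'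
      simp [this]
  · rintro ⟨S, hS, c, hc, rfl⟩
    refine ⟨fun ν => if ν ∈ S then ((Real.sqrt (c ν / π) : ℝ) : ℂ) else 0, ?_, ?_⟩
    · rw [momentMap]
      symm
      rw [← Finset.sum_subset (Finset.subset_univ S)]
      · apply Finset.sum_congr rfl
        intro ν hν
        have hpos := hc ν hν
        have hp := Real.pi_pos
        rw [if_pos hν, Complex.norm_real, Real.norm_eq_abs, sq_abs,
          Real.sq_sqrt (by positivity)]
        congr 1
        field_simp
      · intro ν _ hν
        simp [hν]
    · intro htop
      have h1 : Submodule.span ℝ ((S.image (wR w) : Finset (Fin k → ℝ)) : Set (Fin k → ℝ)) = ⊤ := by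
        rw [eq_top_iff, ← htop]
        apply Submodule.span_mono
        rintro _ ⟨ν, hν, rfl⟩
        have : ν ∈ S := by
          by_contra h
          simp [h] at hν
        simpa using ⟨ν, this, rfl⟩
      have h2 := finrank_span_finset_le_card (R := ℝ) (S.image (wR w))
      have h3 : (S.image (wR w)).card ≤ S.card := Finset.card_image_le
      rw [Set.finrank, h1] at h2
      simp at h2
      omega
end
end

section
/- Let τ ∈ (ℝ^k)* be a regular value of μ, let ζ ∈ ℝ^n satisfy ∑_{ν=1}^n ζ_ν w_ν = −τ, and let I ⊆ {1,…,n}. If Δ_I ≠ ∅, then the affine span of Δ_I in ℝ^n has dimension n − k − |I| (i.e., the direction submodule of the affine span of Δ_I has ℝ-dimension n − k − |I|). -/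
open Real Finset

noncomputable section

/-- `τ` is a regular value of the moment map. -/
def IsRegularValue {k n : ℕ} (w : Fin n → Fin k → ℤ) (τ : Fin k → ℝ) : Prop :=
  ∀ x : Fin n → ℂ, momentMap w x = τ →
    Submodule.span ℝ (wR w '' {ν | x ν ≠ 0}) = ⊤

/-- The face `Δ_I` of the polytope `Δ`. -/
def DeltaFace {k n : ℕ} (w : Fin n → Fin k → ℤ) (ζ : Fin n → ℝ)
    (I : Finset (Fin n)) : Set (Fin n → ℝ) :=
  {η | (∑ ν, η ν • wR w ν = 0) ∧ (∀ ν, ζ ν ≤ η ν) ∧ ∀ ν ∈ I, η ν = ζ ν}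

open Filter Topology in
lemma exists_eps_aux {n : ℕ} (ζ η v : Fin n → ℝ) (I : Finset (Fin n))
    (h : ∀ ν, ν ∉ I → ζ ν < η ν ∨ (ζ ν ≤ η ν ∧ 0 < v ν)) :
    ∃ ε : ℝ, 0 < ε ∧ ∀ ν, ν ∉ I → ζ ν < η ν + ε * v ν := by
  have key : ∀ᶠ ε in 𝓝[>] (0 : ℝ), ∀ ν, ν ∉ I → ζ ν < η ν + ε * v ν := by
    rw [Filter.eventually_all]
    intro ν
    by_cases hν : ν ∈ I
    · exact Filter.Eventually.of_forall fun _ h => absurd hν h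
    rcases h ν hν with h1 | ⟨h1, h2⟩
    · have hc : ContinuousAt (fun ε : ℝ => η ν + ε * v ν) 0 := by fun_prop
      have h3 : ∀ᶠ ε in 𝓝 (0 : ℝ), ζ ν < η ν + ε * v ν :=
        hc.eventually_const_lt (by simpa using h1)
      exact (h3.filter_mono nhdsWithin_le_nhds).mono fun _ h _ => h
    · filter_upwards [self_mem_nhdsWithin] with ε hε _
      have := mul_pos (Set.mem_Ioi.1 hε) h2
      linarith
  obtain ⟨ε, h1, h2⟩ := (key.and self_mem_nhdsWithin).exists
  exact ⟨ε, h2, h1⟩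

lemma exists_solution_aux {k n : ℕ} (u : Fin n → Fin k → ℝ) (S : Set (Fin n))
    (hS : Submodule.span ℝ (u '' S) = ⊤) (g : Fin n → ℝ) (a : Fin k → ℝ) :
    ∃ v : Fin n → ℝ, (∀ ν, ν ∉ S → v ν = g ν) ∧ ∑ ν, v ν • u ν = a := by
  have key : ∀ b : Fin k → ℝ, ∃ c : Fin n → ℝ, (∀ ν, ν ∉ S → c ν = 0) ∧ ∑ ν, c ν • u ν = b := by
    intro b
    have hb : b ∈ Submodule.span ℝ (u '' S) := hS ▸ Submodule.mem_top
    induction hb using Submodule.span_induction with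
    | mem x hx =>
      obtain ⟨ν, hν, rfl⟩ := hx
      refine ⟨Pi.single ν 1, fun μ hμ => ?_, ?_⟩
      · have : μ ≠ ν := fun h => hμ (h ▸ hν)
        simp [this]
      · simp [Pi.single_apply]
    | zero => exact ⟨0, by simp, by simp⟩
    | add x y _ _ hx hy =>
      obtain ⟨c, hc, rfl⟩ := hx
      obtain ⟨d, hd, rfl⟩ := hy
      refine ⟨c + d, fun ν hν => by simp [hc ν hν, hd ν hν], ?_⟩
      simp [add_smul, Finset.sum_add_distrib]
    | smul r x _ hx =>
      obtain ⟨c, hc, rfl⟩ := hx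
      refine ⟨r • c, fun ν hν => by simp [hc ν hν], ?_⟩
      simp [mul_smul, Finset.smul_sum]
  obtain ⟨c, hc, hc2⟩ := key (a - ∑ ν, g ν • u ν)
  refine ⟨c + g, fun ν hν => by simp [hc ν hν], ?_⟩
  simp [add_smul, Finset.sum_add_distrib, hc2]

/-- if `τ` is a regular value and `Δ_I ≠ ∅`, then the affine span of
`Δ_I` has dimension `n - k - |I|`. -/
theorem deltaFace_affineSpan_finrank
    (k n : ℕ) (hk : 1 ≤ k) (hkn : k ≤ n)
    (w : Fin n → Fin k → ℤ)
    (hspan : Submodule.span ℝ (Set.range (wR w)) = ⊤)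
    (τ : Fin k → ℝ) (hreg : IsRegularValue w τ)
    (ζ : Fin n → ℝ) (hζ : ∑ ν, ζ ν • wR w ν = -τ)
    (I : Finset (Fin n)) (hne : (DeltaFace w ζ I).Nonempty) :
    (Module.finrank ℝ ↥((affineSpan ℝ (DeltaFace w ζ I)).direction) : ℤ)
      = (n : ℤ) - k - I.card := by
  classical
  obtain ⟨η, h0, hle, hI⟩ := hne
  -- the span property
  have hS : Submodule.span ℝ (wR w '' {ν | ζ ν < η ν}) = ⊤ := by
    have hx := hreg (fun ν => ((Real.sqrt ((η ν - ζ ν) / π) : ℝ) : ℂ)) ?_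
    · convert hx using 3
      ext ν
      have h1 : (ζ ν < η ν) ↔ 0 < (η ν - ζ ν) / π := by
        rw [div_pos_iff_of_pos_right Real.pi_pos, sub_pos]
      simp only [Set.mem_setOf_eq, ne_eq, Complex.ofReal_eq_zero]
      rw [h1, ← Real.sqrt_pos]
      exact ⟨fun h => h.ne', fun h => lt_of_le_of_ne (Real.sqrt_nonneg _) (Ne.symm h)⟩
    · unfold momentMap
      have h2 : ∀ ν, π * ‖((Real.sqrt ((η ν - ζ ν) / π) : ℝ) : ℂ)‖ ^ 2 = η ν - ζ ν := by
        intro ν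
        rw [Complex.norm_real, Real.norm_eq_abs, sq_abs, Real.sq_sqrt
          (div_nonneg (sub_nonneg.2 (hle ν)) Real.pi_pos.le)]
        field_simp
      simp only [h2, sub_smul, Finset.sum_sub_distrib, h0, hζ]
      simp
  have hIS : ∀ ν ∈ I, ν ∉ {ν | ζ ν < η ν} := fun ν hν h => by
    have := hI ν hν
    simp only [Set.mem_setOf_eq] at h
    linarith
  -- a relative interior point
  obtain ⟨v, hv, hv0⟩ := exists_solution_aux (wR w) _ hS (fun ν => if ν ∈ I then 0 else 1) 0
  obtain ⟨ε, hε, hε2⟩ := exists_eps_aux ζ η v I (fun ν hν => by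
    by_cases h : ζ ν < η ν
    · exact Or.inl h
    · right
      refine ⟨hle ν, ?_⟩
      rw [hv ν h]
      simp [hν])
  have hstep : ∀ (p q : Fin n → ℝ) (r : ℝ), ∑ ν, p ν • wR w ν = 0 → ∑ ν, q ν • wR w ν = 0 →
      ∑ ν, (p ν + r * q ν) • wR w ν = 0 := by
    intro p q r hp hq
    simp only [add_smul, Finset.sum_add_distrib, mul_smul, ← Finset.smul_sum, hp, hq]
    simp
  have hmem : ∀ (p q : Fin n → ℝ) (r : ℝ), ∑ ν, p ν • wR w ν = 0 → ∑ ν, q ν • wR w ν = 0 →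
      (∀ ν ∈ I, p ν = ζ ν) → (∀ ν ∈ I, q ν = 0) → (∀ ν, ν ∉ I → ζ ν < p ν + r * q ν) →
      (fun ν => p ν + r * q ν) ∈ DeltaFace w ζ I := by
    intro p q r hp hq hpI hqI hlt
    refine ⟨hstep p q r hp hq, fun ν => ?_, fun ν hν => by simp [hpI ν hν, hqI ν hν]⟩
    by_cases hν : ν ∈ I
    · simp [hpI ν hν, hqI ν hν]
    · exact (hlt ν hν).le
  have hvI : ∀ ν ∈ I, v ν = 0 := fun ν hν => by
    rw [hv ν (hIS ν hν)]; simp [hν]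
  have hη1 := hmem η v ε h0 hv0 hI hvI hε2
  set η1 : Fin n → ℝ := fun ν => η ν + ε * v ν with hη1def
  let L : (Fin n → ℝ) →ₗ[ℝ] (Fin k → ℝ) × (I → ℝ) :=
    (Fintype.linearCombination ℝ (wR w)).prod (LinearMap.funLeft ℝ ℝ (fun i : I => (i : Fin n)))
  have hLker : ∀ x, x ∈ LinearMap.ker L ↔ (∑ ν, x ν • wR w ν = 0) ∧ ∀ ν ∈ I, x ν = 0 := by
    intro x
    simp [L, LinearMap.mem_ker, Fintype.linearCombination_apply, funext_iff, LinearMap.funLeft]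
  have hLsurj : LinearMap.range L = ⊤ := by
    rw [LinearMap.range_eq_top]
    rintro ⟨a, b⟩
    obtain ⟨x, hx, hxa⟩ := exists_solution_aux (wR w) _ hS
      (fun ν => if h : ν ∈ I then b ⟨ν, h⟩ else 0) a
    refine ⟨x, Prod.ext ?_ ?_⟩
    · simpa [L, Fintype.linearCombination_apply] using hxa
    · funext i
      have := hx i (hIS i i.2)
      simpa [L, LinearMap.funLeft] using this
  have hdir : (affineSpan ℝ (DeltaFace w ζ I)).direction = LinearMap.ker L := by
    rw [direction_affineSpan]
    apply le_antisymm
    · rw [vectorSpan_def, Submodule.span_le]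
      rintro _ ⟨p, hp, q, hq, rfl⟩
      rw [SetLike.mem_coe, hLker]
      refine ⟨?_, fun ν hν => ?_⟩
      · simp [sub_smul, Finset.sum_sub_distrib, hp.1, hq.1]
      · simp [hp.2.2 ν hν, hq.2.2 ν hν]
    · intro x hx
      rw [hLker] at hx
      obtain ⟨r, hr, hr2⟩ := exists_eps_aux ζ η1 x I (fun ν hν => Or.inl (hε2 ν hν))
      have h2 := hmem η1 x r hη1.1 hx.1 hη1.2.2 hx.2 hr2
      have h3 := vsub_mem_vectorSpan ℝ h2 hη1
      have h4 : x = r⁻¹ • ((fun ν => η1 ν + r * x ν) -ᵥ η1) := by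
        funext ν
        simp [hr.ne']
      rw [h4]
      exact Submodule.smul_mem _ _ h3
  rw [hdir]
  have hrn := LinearMap.finrank_range_add_finrank_ker L
  rw [hLsurj, finrank_top] at hrn
  simp at hrn
  omega
end
end

section
/- Let τ ∈ (ℝ^k)* be a regular value of μ, let ζ ∈ ℝ^n satisfy ∑_{ν=1}^n ζ_ν w_ν = −τ, and let I ⊆ {1,…,n}. Then Δ_I = ∅ if and only if τ ∉ C({1,…,n}∖I). -/
open Real Finset

noncomputable section

/-- The cone `C(S)` spanned by the vectors `w_ν`, `ν ∈ S`. -/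
def cone {k n : ℕ} (w : Fin n → Fin k → ℤ) (S : Finset (Fin n)) : Set (Fin k → ℝ) :=
  {t | ∃ c : Fin n → ℝ, (∀ ν, 0 ≤ c ν) ∧ t = ∑ ν ∈ S, c ν • wR w ν}

/-- if `τ` is a regular value of `μ`, then `Δ_I = ∅` if and only if
`τ ∉ C({1,…,n} \ I)`. -/
theorem deltaFace_empty_iff_not_mem_cone
    (k n : ℕ) (hk : 1 ≤ k) (hkn : k ≤ n)
    (w : Fin n → Fin k → ℤ)
    (hspan : Submodule.span ℝ (Set.range (wR w)) = ⊤)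
    (τ : Fin k → ℝ) (hreg : IsRegularValue w τ)
    (ζ : Fin n → ℝ) (hζ : ∑ ν, ζ ν • wR w ν = -τ)
    (I : Finset (Fin n)) :
    DeltaFace w ζ I = ∅ ↔ τ ∉ cone w Iᶜ := by
  rw [← Set.not_nonempty_iff_eq_empty, not_iff_not]
  constructor
  · rintro ⟨η, h0, h1, h2⟩
    refine ⟨fun ν => η ν - ζ ν, fun ν => sub_nonneg.2 (h1 ν), ?_⟩
    have hs : ∑ ν ∈ I, (η ν - ζ ν) • wR w ν = 0 :=
      Finset.sum_eq_zero fun ν hν => by rw [h2 ν hν, sub_self, zero_smul]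
    have ht := Finset.sum_add_sum_compl I (fun ν => (η ν - ζ ν) • wR w ν)
    rw [hs, zero_add] at ht
    rw [ht]
    simp only [sub_smul, Finset.sum_sub_distrib, h0, hζ, zero_sub, neg_neg]
  · rintro ⟨c, hc, hτ⟩
    refine ⟨fun ν => ζ ν + if ν ∈ I then 0 else c ν, ?_, ?_, ?_⟩
    · simp only [add_smul, Finset.sum_add_distrib, hζ]
      rw [← Finset.sum_add_sum_compl I (fun ν => (if ν ∈ I then 0 else c ν) • wR w ν)]
      have h1 : ∑ ν ∈ I, (if ν ∈ I then 0 else c ν) • wR w ν = 0 :=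
        Finset.sum_eq_zero fun ν hν => by rw [if_pos hν, zero_smul]
      have h2 : ∑ ν ∈ Iᶜ, (if ν ∈ I then 0 else c ν) • wR w ν = τ := by
        rw [hτ]
        exact Finset.sum_congr rfl fun ν hν => by rw [if_neg (Finset.mem_compl.1 hν)]
      rw [h1, h2, zero_add, neg_add_cancel]
    · intro ν
      have := hc ν
      dsimp only
      split_ifs <;> linarith
    · intro ν hν
      simp [hν]
end
end

section
/- Let τ ∈ (ℝ^k)* be a regular value of μ and let J ⊆ {1,…,n}. If there exist real numbers a_ν ≥ 0 (ν ∈ J) with τ = ∑_{ν∈J} a_ν w_ν, then there exist real numbers b_ν > 0 (ν ∈ J) with τ = ∑_{ν∈J} b_ν w_ν. -/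
open Real Finset

noncomputable section

/-- if a regular value `τ` is a nonnegative combination of the
`w_ν`, `ν ∈ J`, then it is a positive combination of them. -/
theorem regular_value_pos_comb_of_nonneg_comb
    (k n : ℕ) (hk : 1 ≤ k) (hkn : k ≤ n)
    (w : Fin n → Fin k → ℤ)
    (hspan : Submodule.span ℝ (Set.range (wR w)) = ⊤)
    (τ : Fin k → ℝ) (hreg : IsRegularValue w τ)
    (J : Finset (Fin n))
    (a : Fin n → ℝ) (ha : ∀ ν ∈ J, 0 ≤ a ν)
    (hτ : τ = ∑ ν ∈ J, a ν • wR w ν) :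
    ∃ b : Fin n → ℝ, (∀ ν ∈ J, 0 < b ν) ∧ τ = ∑ ν ∈ J, b ν • wR w ν := by
  classical
  have hx : momentMap w (fun ν => if ν ∈ J then ((√(a ν / π) : ℝ) : ℂ) else 0) = τ := by
    rw [hτ, momentMap, ← Finset.sum_subset (Finset.subset_univ J)]
    · refine Finset.sum_congr rfl fun ν hν => ?_
      congr 1
      have h0 : 0 ≤ a ν / π := div_nonneg (ha ν hν) Real.pi_pos.le
      simp only [hν, if_true, Complex.norm_real, Real.norm_eq_abs, sq_abs]
      rw [Real.sq_sqrt h0]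
      field_simp
    · intro ν _ hν
      simp [hν]
  have hS := hreg _ hx
  have hmem : (∑ ν ∈ J, wR w ν) ∈ Submodule.span ℝ (wR w '' ((J.filter fun ν => a ν ≠ 0 : Finset (Fin n)) : Set (Fin n))) := by
    have hsub : {ν | (if ν ∈ J then ((√(a ν / π) : ℝ) : ℂ) else 0) ≠ 0} ⊆ ((J.filter fun ν => a ν ≠ 0 : Finset (Fin n)) : Set (Fin n)) := by
      intro ν hν
      simp only [Set.mem_ofPred_eq] at hν
      by_cases h : ν ∈ J
      · simp only [Finset.coe_filter, Set.mem_ofPred_eq]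
        refine ⟨h, fun h0 => hν ?_⟩
        simp [h0]
      · simp [h] at hν
    have := Submodule.span_mono (R := ℝ) (Set.image_mono (f := wR w) hsub)
    apply this
    rw [hS]
    trivial
  rw [Submodule.mem_span_image_finset_iff_exists_fun'] at hmem
  obtain ⟨c, hc⟩ := hmem
  rw [Finset.sum_filter] at hc
  have hev : ∀ᶠ ε : ℝ in nhdsWithin 0 (Set.Ioi 0), ∀ ν ∈ J, 0 < a ν + ε * (1 - if a ν ≠ 0 then c ν else 0) := by
    rw [Filter.eventually_all_finset]
    intro ν hν
    by_cases h : a ν = 0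
    · filter_upwards [self_mem_nhdsWithin] with ε hε
      simpa [h] using hε
    · have hpos : 0 < a ν := lt_of_le_of_ne (ha ν hν) (Ne.symm h)
      apply Filter.Eventually.filter_mono nhdsWithin_le_nhds
      have hcont : Continuous fun ε : ℝ => a ν + ε * (1 - if a ν ≠ 0 then c ν else 0) := by
        fun_prop
      exact hcont.continuousAt.eventually (lt_mem_nhds (by simpa using hpos))
  obtain ⟨ε, hε⟩ := hev.exists
  refine ⟨_, hε, ?_⟩
  have hz : ∑ ν ∈ J, (1 - if a ν ≠ 0 then c ν else 0) • wR w ν = 0 := by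
    simp only [sub_smul, one_smul, Finset.sum_sub_distrib]
    rw [← hc, sub_eq_zero]
    exact Finset.sum_congr rfl fun ν _ => by split_ifs <;> simp
  simp only [add_smul, mul_smul, Finset.sum_add_distrib, ← Finset.smul_sum]
  rw [hz, smul_zero, add_zero, hτ]
end
end

section
/- Let V := {(⟨w_1,ξ⟩,…,⟨w_n,ξ⟩) : ξ ∈ ℝ^k} ⊆ ℝ^n, let π̄ : ℝ^n → ℝ^n/V be the quotient map, let ē_ν := π̄(e_ν) denote the images of the standard basis vectors of ℝ^n, and let Λ̄ := π̄(ℤ^n) ⊆ ℝ^n/V. Suppose τ ∈ (ℝ^k)* is a regular value of μ, the torus T = ℝ^k/ℤ^k acts freely on μ^{−1}(τ), ζ ∈ ℝ^n satisfies ∑_{ν=1}^n ζ_ν w_ν = −τ, and J ⊆ {1,…,n} satisfies |J| = n − k and Δ_J ≠ ∅. Then (ē_j)_{j∈J} is a ℤ-basis of Λ̄: every element of Λ̄ can be written as a ℤ-linear combination of {ē_j : j ∈ J} in exactly one way. -/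
open Real Finset

noncomputable section

/-- The torus `T = ℝ^k/ℤ^k` acts freely on `μ⁻¹(τ)`. -/
def ActsFreely {k n : ℕ} (w : Fin n → Fin k → ℤ) (τ : Fin k → ℝ) : Prop :=
  ∀ x : Fin n → ℂ, momentMap w x = τ → ∀ ξ : Fin k → ℝ,
    (∀ ν, Complex.exp (-(2 * (π : ℂ) * Complex.I) * ∑ i, (w ν i : ℂ) * (ξ i : ℂ)) * x ν = x ν) →
    ∀ i, ∃ m : ℤ, ξ i = (m : ℝ)

/-- The subspace `V = {(⟨w_1,ξ⟩,…,⟨w_n,ξ⟩) : ξ ∈ ℝ^k} ⊆ ℝ^n`. -/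
def rowSpace {k n : ℕ} (w : Fin n → Fin k → ℤ) : Submodule ℝ (Fin n → ℝ) :=
  LinearMap.range (Matrix.mulVecLin (Matrix.of fun ν i => (w ν i : ℝ)))

/-- rewrite the combination as the image of an integer vector -/
theorem aux_sum {k n : ℕ} (w : Fin n → Fin k → ℤ) (J : Finset (Fin n)) (c : Fin n → ℤ)
    (hc : ∀ ν ∉ J, c ν = 0) :
    ∑ ν ∈ J, c ν • (rowSpace w).mkQ (Pi.single ν 1) =
      (rowSpace w).mkQ (fun ν => (c ν : ℝ)) := by
  have : (fun ν => (c ν : ℝ)) = ∑ ν ∈ J, c ν • (Pi.single ν (1:ℝ) : Fin n → ℝ) := by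
    funext a
    rw [Finset.sum_apply]
    by_cases ha : a ∈ J
    · rw [Finset.sum_eq_single a]
      · simp
      · intro b _ hb
        simp [Pi.single_apply, hb.symm]
      · intro h; exact absurd ha h
    · rw [Finset.sum_eq_zero]
      · simp [hc a ha]
      · intro b hb
        have : a ≠ b := fun h => ha (h ▸ hb)
        simp [Pi.single_apply, this]
  rw [this, map_sum]
  refine Finset.sum_congr rfl fun ν _ => ?_
  rw [map_zsmul]

/-- if `T` acts freely on `μ⁻¹(τ)`, `|J| = n - k` and `Δ_J ≠ ∅`, then
the images `ē_j`, `j ∈ J`, of the standard basis vectors form a `ℤ`-basis of the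
image `Λ̄` of `ℤ^n` in `ℝ^n / V`: every element of `Λ̄` is a `ℤ`-linear
combination of `{ē_j : j ∈ J}` in exactly one way. -/
theorem lattice_basis_of_vertex
    (k n : ℕ) (hk : 1 ≤ k) (hkn : k ≤ n)
    (w : Fin n → Fin k → ℤ)
    (hspan : Submodule.span ℝ (Set.range (wR w)) = ⊤)
    (τ : Fin k → ℝ) (hreg : IsRegularValue w τ)
    (hfree : ActsFreely w τ)
    (ζ : Fin n → ℝ) (hζ : ∑ ν, ζ ν • wR w ν = -τ)
    (J : Finset (Fin n)) (hJ : J.card = n - k)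
    (hne : (DeltaFace w ζ J).Nonempty) :
    ∀ v : (Fin n → ℝ) ⧸ rowSpace w,
      (∃ m : Fin n → ℤ, v = (rowSpace w).mkQ (fun ν => (m ν : ℝ))) →
      ∃! c : Fin n → ℤ, (∀ ν ∉ J, c ν = 0) ∧
        v = ∑ ν ∈ J, c ν • (rowSpace w).mkQ (Pi.single ν 1) := by
  obtain ⟨η, hη0, hηge, hηJ⟩ := hne
  obtain ⟨x, hxμ, hxJ⟩ : ∃ x : Fin n → ℂ, momentMap w x = τ ∧ ∀ ν ∈ J, x ν = 0 := by
    refine ⟨fun ν => ((Real.sqrt ((η ν - ζ ν) / π) : ℝ) : ℂ), ?_, ?_⟩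
    · have h1 : ∀ ν, (π * ‖((Real.sqrt ((η ν - ζ ν) / π) : ℝ) : ℂ)‖ ^ 2) • wR w ν
          = η ν • wR w ν - ζ ν • wR w ν := by
        intro ν
        rw [← sub_smul, Complex.norm_real, Real.norm_eq_abs, sq_abs, Real.sq_sqrt]
        · congr 1
          field_simp
        · exact div_nonneg (sub_nonneg.2 (hηge ν)) Real.pi_pos.le
      unfold momentMap
      simp only [h1, Finset.sum_sub_distrib, hη0, hζ]
      simp
    · intro ν hν
      simp [hηJ ν hν]
  have hsp := hreg x hxμ
  -- pairing with the weights
  let L : (Fin k → ℝ) →ₗ[ℝ] ({ν // ν ∈ Jᶜ} → ℝ) :=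
    Matrix.mulVecLin (Matrix.of fun (ν : {ν // ν ∈ Jᶜ}) i => (w ν i : ℝ))
  have hL : ∀ ξ ν, L ξ ν = ∑ i, (w ν i : ℝ) * ξ i := fun ξ ν => rfl
  have hinj : Function.Injective L := by
    rw [injective_iff_map_eq_zero]
    intro ξ hξ
    let f : (Fin k → ℝ) →ₗ[ℝ] ℝ := dotProductBilin ℝ ℝ ξ
    have hf : ∀ y, f y = ∑ i, ξ i * y i := fun y => rfl
    have hker : (⊤ : Submodule ℝ (Fin k → ℝ)) ≤ LinearMap.ker f := by
      rw [← hsp, Submodule.span_le]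
      rintro _ ⟨ν, hν, rfl⟩
      have hνJ : ν ∈ Jᶜ := by
        rw [Finset.mem_compl]; exact fun h => hν (hxJ ν h)
      have := congrFun hξ ⟨ν, hνJ⟩
      rw [hL] at this
      simp only [SetLike.mem_coe, LinearMap.mem_ker, hf]
      rw [← Pi.zero_apply (M := fun _ => ℝ) (⟨ν, hνJ⟩ : {ν // ν ∈ Jᶜ}), ← this]
      exact Finset.sum_congr rfl fun i _ => mul_comm _ _
    have h2 : f ξ = 0 := hker (Submodule.mem_top)
    exact dotProduct_self_eq_zero.1 h2
  have hsurj : Function.Surjective L := by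
    refine (LinearMap.injective_iff_surjective_of_finrank_eq_finrank ?_).1 hinj
    simp [Finset.card_compl, hJ]
    omega
  rintro v ⟨m, rfl⟩
  obtain ⟨ξ, hξ⟩ := hsurj (fun ν => (m ν : ℝ))
  have hint := hfree x hxμ ξ (by
    intro ν
    by_cases hν : ν ∈ J
    · simp [hxJ ν hν]
    · have h := congrFun hξ ⟨ν, Finset.mem_compl.2 hν⟩
      rw [hL] at h
      have h' : ∑ i, (w ν i : ℂ) * (ξ i : ℂ) = (m ν : ℂ) := by
        have := congrArg (fun r : ℝ => (r : ℂ)) h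
        push_cast at this
        exact this
      rw [h']
      have : Complex.exp (-(2 * (π : ℂ) * Complex.I) * (m ν : ℂ)) = 1 := by
        rw [Complex.exp_eq_one_iff]
        exact ⟨-m ν, by push_cast; ring⟩
      rw [this, one_mul])
  choose z hz using hint
  have hmem : ∀ y : Fin n → ℝ, y ∈ rowSpace w ↔
      ∃ u : Fin k → ℝ, ∀ ν, ∑ i, (w ν i : ℝ) * u i = y ν := by
    intro y
    constructor
    · rintro ⟨u, rfl⟩
      exact ⟨u, fun ν => rfl⟩
    · rintro ⟨u, hu⟩
      exact ⟨u, funext hu⟩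
  have hc0 : ∀ ν ∉ J, m ν - ∑ i, w ν i * z i = 0 := by
    intro ν hν
    have h := congrFun hξ ⟨ν, Finset.mem_compl.2 hν⟩
    rw [hL] at h
    simp only [hz] at h
    have h' : ∑ i, w ν i * z i = m ν := by exact_mod_cast h
    omega
  refine ⟨fun ν => m ν - ∑ i, w ν i * z i, ⟨hc0, ?_⟩, ?_⟩
  · rw [aux_sum w J _ hc0]
    simp only [Submodule.mkQ_apply]
    rw [Submodule.Quotient.eq, hmem]
    refine ⟨ξ, fun ν => ?_⟩
    simp [hz]
  · rintro c ⟨hc, hv⟩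
    rw [aux_sum w J _ hc] at hv
    simp only [Submodule.mkQ_apply] at hv
    rw [Submodule.Quotient.eq, hmem] at hv
    obtain ⟨u, hu⟩ := hv
    have huξ : u = ξ := by
      apply hinj
      rw [hξ]
      funext ν
      rw [hL, hu]
      simp [hc ν (Finset.mem_compl.1 ν.2)]
    subst huξ
    funext ν
    have h := hu ν
    simp only [hz, Pi.sub_apply] at h
    have h' : ∑ i, w ν i * z i = m ν - c ν := by exact_mod_cast h
    omega
end
end

section
/- Suppose μ is a proper map, τ ∈ (ℝ^k)* is a regular value of μ, μ^{−1}(τ) ≠ ∅, and the torus T = ℝ^k/ℤ^k acts freely on μ^{−1}(τ). Let d ∈ ℤ^n and suppose there exists ξ ∈ ℝ^k with d_ν = ⟨w_ν, ξ⟩ for all ν = 1,…,n. Then there exists λ ∈ ℤ^k with d_ν = ⟨w_ν, λ⟩ for all ν (equivalently, ξ ∈ ℤ^k). -/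
open Real Finset

noncomputable section

/-- if `μ` is proper, `τ` is a regular value with nonempty fiber on
which `T` acts freely, and `d ∈ ℤ^n` satisfies `d_ν = ⟨w_ν, ξ⟩` for some
`ξ ∈ ℝ^k`, then there is a lattice vector `λ ∈ ℤ^k` with `d_ν = ⟨w_ν, λ⟩`. -/
theorem integral_degrees_from_lattice_vector
    (k n : ℕ) (hk : 1 ≤ k) (hkn : k ≤ n)
    (w : Fin n → Fin k → ℤ)
    (hspan : Submodule.span ℝ (Set.range (wR w)) = ⊤)
    (τ : Fin k → ℝ)
    (hproper : IsProperMap (momentMap w))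
    (hreg : IsRegularValue w τ)
    (hne : ∃ x, momentMap w x = τ)
    (hfree : ActsFreely w τ)
    (d : Fin n → ℤ) (ξ : Fin k → ℝ)
    (hd : ∀ ν, (d ν : ℝ) = ∑ i, (w ν i : ℝ) * ξ i) :
    ∃ l : Fin k → ℤ, ∀ ν, d ν = ∑ i, w ν i * l i := by
  obtain ⟨x, hx⟩ := hne
  have key : ∀ i, ∃ m : ℤ, ξ i = (m : ℝ) := by
    refine hfree x hx ξ (fun ν => ?_)
    have h : (∑ i, (w ν i : ℂ) * (ξ i : ℂ)) = (d ν : ℂ) := by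
      have h2 := congrArg (fun r : ℝ => (r : ℂ)) (hd ν)
      push_cast at h2
      exact h2.symm
    have h1 : Complex.exp (-(2 * (π : ℂ) * Complex.I) * (d ν : ℂ)) = 1 := by
      rw [Complex.exp_eq_one_iff]
      refine ⟨-(d ν), ?_⟩
      push_cast
      ring
    rw [h, h1, one_mul]
  choose l hl using key
  refine ⟨l, fun ν => ?_⟩
  have h := hd ν
  simp only [hl] at h
  exact_mod_cast h
end
end

section
/- Suppose μ is a proper map, τ ∈ (ℝ^k)* is a regular value of μ, μ^{−1}(τ) ≠ ∅, and the torus T = ℝ^k/ℤ^k acts freely on μ^{−1}(τ). Then the ideal ℐ_τ of ℝ[u_1,…,u_n] equals the ideal generated by: (a) all linear polynomials ∑_{ν=1}^n η_ν u_ν with η ∈ ℝ^n satisfying ∑_ν η_ν w_ν = 0; (b) the variables u_ν for those ν ∈ {1,…,n} with τ ∉ C({1,…,n}∖{ν}); and (c) the monomials u^{d⁺} for all d ∈ D_eff(τ) with d ≠ 0. -/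
open Real Finset

noncomputable section

/-- The set of regular values of the moment map. -/
def regularValues {k n : ℕ} (w : Fin n → Fin k → ℤ) : Set (Fin k → ℝ) :=
  {τ | ∀ x : Fin n → ℂ, momentMap w x = τ →
    Submodule.span ℝ (wR w '' {ν | x ν ≠ 0}) = ⊤}

/-- The chamber of a regular value `τ`: the connected component of the set of
regular values containing `τ`. -/
def chamber {k n : ℕ} (w : Fin n → Fin k → ℤ) (τ : Fin k → ℝ) : Set (Fin k → ℝ) :=
  connectedComponentIn (regularValues w) τ

/-- The effective cone `Λ_eff(τ) ⊆ Λ(τ) ⊆ ℤ^k`. -/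
def LambdaEff {k n : ℕ} (w : Fin n → Fin k → ℤ) (τ : Fin k → ℝ) : Set (Fin k → ℤ) :=
  {l | (∀ ν : Fin n, τ ∉ cone w ({ν}ᶜ) → ∑ i, w ν i * l i = 0) ∧
    ∀ τ' ∈ chamber w τ, 0 ≤ ∑ i, τ' i * (l i : ℝ)}

/-- The ideal `ℐ_τ ⊆ ℝ[u_1,…,u_n]` generated by the covector relations and the
monomials `∏_{ν∈I} u_ν` for all `I` with `τ ∉ C({1,…,n}∖I)`. -/
def idealI {k n : ℕ} (w : Fin n → Fin k → ℤ) (τ : Fin k → ℝ) :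
    Ideal (MvPolynomial (Fin n) ℝ) :=
  Ideal.span
    ({p | ∃ η : Fin n → ℝ, (∑ ν, η ν • wR w ν = 0) ∧
        p = ∑ ν, MvPolynomial.C (η ν) * MvPolynomial.X ν} ∪
      {p | ∃ I : Finset (Fin n), τ ∉ cone w Iᶜ ∧ p = ∏ ν ∈ I, MvPolynomial.X ν})


/-- Auxiliary linear map `y ↦ ∑ y_ν w_ν`. -/
def auxM {k n : ℕ} (w : Fin n → Fin k → ℤ) : (Fin n → ℝ) →ₗ[ℝ] (Fin k → ℝ) :=
  Fintype.linearCombination ℝ (wR w)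

lemma auxM_apply {k n : ℕ} (w : Fin n → Fin k → ℤ) (y : Fin n → ℝ) :
    auxM w y = ∑ ν, y ν • wR w ν := rfl

lemma momentMap_eq {k n : ℕ} (w : Fin n → Fin k → ℤ) (x : Fin n → ℂ) :
    momentMap w x = auxM w (fun ν => π * ‖x ν‖ ^ 2) := rfl

lemma exists_lift {n : ℕ} (y : Fin n → ℝ) (hy : ∀ ν, 0 ≤ y ν) :
    ∃ x : Fin n → ℂ, (fun ν => π * ‖x ν‖ ^ 2) = y ∧ ∀ ν, x ν = 0 ↔ y ν = 0 := by
  have hx : (fun ν => π * ‖((Real.sqrt (y ν / π) : ℝ) : ℂ)‖ ^ 2) = y := by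
    funext ν
    have h : 0 ≤ y ν / π := div_nonneg (hy ν) pi_pos.le
    simp only [Complex.norm_real, Real.norm_eq_abs, sq_abs]
    rw [Real.sq_sqrt h]
    field_simp
  refine ⟨fun ν => ((Real.sqrt (y ν / π) : ℝ) : ℂ), hx, fun ν => ?_⟩
  have h := congrFun hx ν
  constructor
  · intro h0
    rw [← h]
    simp only at h0
    rw [h0]; simp
  · intro h0
    simp [h0]

lemma mem_cone_iff {k n : ℕ} (w : Fin n → Fin k → ℤ) (S : Finset (Fin n)) (t : Fin k → ℝ) :
    t ∈ cone w S ↔ ∃ y : Fin n → ℝ, (∀ ν, 0 ≤ y ν) ∧ (∀ ν, ν ∉ S → y ν = 0) ∧ auxM w y = t := by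
  constructor
  · rintro ⟨c, hc, rfl⟩
    refine ⟨fun ν => if ν ∈ S then c ν else 0, fun ν => ?_, fun ν h => by simp [h], ?_⟩
    · dsimp only
      split_ifs
      exacts [hc ν, le_rfl]
    · simp [auxM_apply, ite_smul]
  · rintro ⟨y, hy, hS, rfl⟩
    refine ⟨y, hy, ?_⟩
    rw [auxM_apply]
    symm
    exact Finset.sum_subset (Finset.subset_univ S) (fun ν _ h => by simp [hS ν h])

lemma cone_closed {k n : ℕ} (w : Fin n → Fin k → ℤ) (hproper : IsProperMap (momentMap w))
    (S : Finset (Fin n)) : IsClosed (cone w S) := by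
  have h : cone w S = momentMap w '' {x | ∀ ν, ν ∉ S → x ν = 0} := by
    ext t
    rw [mem_cone_iff]
    constructor
    · rintro ⟨y, hy, hS, rfl⟩
      obtain ⟨x, hx, hx0⟩ := exists_lift y hy
      exact ⟨x, fun ν h => (hx0 ν).2 (hS ν h), by rw [momentMap_eq, hx]⟩
    · rintro ⟨x, hx, rfl⟩
      exact ⟨_, fun ν => by positivity, fun ν h => by simp [hx ν h], (momentMap_eq w x).symm⟩
  rw [h]
  apply hproper.isClosedMap
  simp only [Set.ofPred_forall]
  exact isClosed_iInter fun ν => isClosed_iInter fun _ =>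
    isClosed_eq (continuous_apply ν) continuous_const

lemma reg_iff {k n : ℕ} (w : Fin n → Fin k → ℤ) (t : Fin k → ℝ) :
    t ∈ regularValues w ↔ ∀ y : Fin n → ℝ, (∀ ν, 0 ≤ y ν) → auxM w y = t →
      Submodule.span ℝ (wR w '' {ν | y ν ≠ 0}) = ⊤ := by
  constructor
  · intro h y hy hyt
    obtain ⟨x, hx, hx0⟩ := exists_lift y hy
    have := h x (by rw [momentMap_eq, hx, hyt])
    simpa only [ne_eq, hx0] using this
  · intro h x hx
    have := h _ (fun ν => by positivity) hx
    simpa [pi_ne_zero] using this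

lemma reg_open {k n : ℕ} (w : Fin n → Fin k → ℤ) (hproper : IsProperMap (momentMap w)) :
    IsOpen (regularValues w) := by
  have h : (regularValues w)ᶜ = ⋃ S ∈ {S : Finset (Fin n) |
      Submodule.span ℝ (wR w '' (S : Set (Fin n))) ≠ ⊤}, cone w S := by
    ext t
    simp only [Set.mem_compl_iff, reg_iff, Set.mem_iUnion, mem_cone_iff]
    constructor
    · intro h
      push Not at h
      obtain ⟨y, hy, hyt, hs⟩ := h
      refine ⟨Finset.univ.filter (fun ν => y ν ≠ 0), ?_, y, hy, ?_, hyt⟩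
      · simpa using hs
      · simp
    · rintro ⟨S, hS, y, hy, hyS, hyt⟩ h
      apply hS
      rw [eq_top_iff, ← h y hy hyt]
      apply Submodule.span_mono
      apply Set.image_mono
      intro ν hν
      by_contra hc
      exact hν (hyS ν hc)
  rw [← isClosed_compl_iff, h]
  exact Set.Finite.isClosed_biUnion (Set.toFinite _) (fun S _ => cone_closed w hproper S)

lemma exists_supp {k n : ℕ} (w : Fin n → Fin k → ℤ) (s : Set (Fin n))
    (h : Submodule.span ℝ (wR w '' s) = ⊤) (t : Fin k → ℝ) :
    ∃ a : Fin n → ℝ, (∀ ν, ν ∉ s → a ν = 0) ∧ auxM w a = t := by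
  have ht : t ∈ Submodule.span ℝ (wR w '' s) := by rw [h]; trivial
  induction ht using Submodule.span_induction with
  | mem x hx =>
    obtain ⟨ν, hν, rfl⟩ := hx
    refine ⟨Pi.single ν 1, fun μ hμ => ?_, ?_⟩
    · have : μ ≠ ν := by rintro rfl; exact hμ hν
      simp [this]
    · simp [auxM]
  | zero => exact ⟨0, by simp, by simp⟩
  | add x y _ _ hx hy =>
    obtain ⟨a, ha, rfl⟩ := hx
    obtain ⟨b, hb, rfl⟩ := hy
    exact ⟨a + b, fun ν h => by simp [ha ν h, hb ν h], by simp⟩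
  | smul c x _ hx =>
    obtain ⟨a, ha, rfl⟩ := hx
    exact ⟨c • a, fun ν h => by simp [ha ν h], by simp⟩

/-- Moving a little in a direction that is nonnegative off the support stays nonnegative. -/
lemma exists_eps {n : ℕ} (y v : Fin n → ℝ) (hy : ∀ ν, 0 ≤ y ν) (hv : ∀ ν, y ν = 0 → 0 ≤ v ν) :
    ∃ ε : ℝ, 0 < ε ∧ ∀ ν, 0 ≤ y ν + ε * v ν := by
  have h : ∀ ν, ∀ᶠ ε in nhdsWithin (0 : ℝ) (Set.Ioi 0), 0 ≤ y ν + ε * v ν := by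
    intro ν
    rcases (hy ν).eq_or_lt with h0 | h0
    · filter_upwards [self_mem_nhdsWithin] with ε hε
      rw [← h0, zero_add]
      exact mul_nonneg (le_of_lt hε) (hv ν h0.symm)
    · have hc : ContinuousAt (fun ε : ℝ => y ν + ε * v ν) 0 := by fun_prop
      have := hc.eventually (lt_mem_nhds (a := 0) (by simpa using h0))
      exact (this.filter_mono nhdsWithin_le_nhds).mono fun ε h => le_of_lt h
  have h2 := (Filter.eventually_all.2 h).and self_mem_nhdsWithin
  obtain ⟨ε, h1, h2⟩ := h2.exists
  exact ⟨ε, h2, h1⟩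

lemma chamber_subset_cone {k n : ℕ} (w : Fin n → Fin k → ℤ) (hproper : IsProperMap (momentMap w))
    (τ : Fin k → ℝ) (S : Finset (Fin n)) (hτ : τ ∈ cone w S) (hreg : τ ∈ regularValues w) :
    chamber w τ ⊆ cone w S := by
  have hnhds : ∀ t ∈ regularValues w, t ∈ cone w S → cone w S ∈ nhds t := by
    intro t ht htS
    obtain ⟨y, hy, hyS, hyt⟩ := (mem_cone_iff w S t).1 htS
    have hs := (reg_iff w t).1 ht y hy hyt
    -- the linear map restricted to the support
    let E : Submodule ℝ (Fin n → ℝ) :=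
      { carrier := {v | ∀ ν, y ν = 0 → v ν = 0}
        add_mem' := fun {a b} ha hb ν h => by simp [ha ν h, hb ν h]
        zero_mem' := fun ν h => rfl
        smul_mem' := fun c a ha ν h => by simp [ha ν h] }
    let f : E →ₗ[ℝ] (Fin k → ℝ) := (auxM w).domRestrict E
    have hf : Function.Surjective f := by
      intro u
      obtain ⟨a, ha, hau⟩ := exists_supp w _ hs u
      exact ⟨⟨a, fun ν h => ha ν (by simp [h])⟩, hau⟩
    have hopen : IsOpenMap f := f.isOpenMap_of_finiteDimensional hf
    let y' : E := ⟨y, fun ν h => h⟩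
    have hU : {v : E | ∀ ν, 0 ≤ v.1 ν} ∈ nhds y' := by
      have h : ∀ ν, ∀ᶠ v : E in nhds y', 0 ≤ v.1 ν := by
        intro ν
        rcases (hy ν).eq_or_lt with h0 | h0
        · exact Filter.Eventually.of_forall fun v => (v.2 ν h0.symm).ge
        · have hc : ContinuousAt (fun v : E => v.1 ν) y' :=
            ((continuous_apply ν).comp continuous_subtype_val).continuousAt
          exact (hc.eventually (lt_mem_nhds (a := 0) h0)).mono fun v h => le_of_lt h
      exact Filter.eventually_all.2 h
    have := hopen.image_mem_nhds hU
    have hft : f y' = t := hyt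
    rw [hft] at this
    refine Filter.mem_of_superset this ?_
    rintro _ ⟨v, hv, rfl⟩
    exact (mem_cone_iff w S _).2 ⟨v.1, hv, fun ν h => v.2 ν (hyS ν h), rfl⟩
  have hpre : IsPreconnected (chamber w τ) := isPreconnected_connectedComponentIn
  have hsub : chamber w τ ⊆ regularValues w := connectedComponentIn_subset _ _
  have hmem : τ ∈ chamber w τ := mem_connectedComponentIn hreg
  have hcl := cone_closed w hproper S
  by_contra hcon
  obtain ⟨t, ht, htS⟩ := Set.not_subset.1 hcon
  obtain ⟨z, hz, hz1, hz2⟩ := hpre (interior (cone w S)) (cone w S)ᶜ isOpen_interior hcl.isOpen_compl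
    (by
      intro z hz
      by_cases h : z ∈ cone w S
      · exact Or.inl (mem_interior_iff_mem_nhds.2 (hnhds z (hsub hz) h))
      · exact Or.inr h)
    ⟨τ, hmem, mem_interior_iff_mem_nhds.2 (hnhds τ hreg hτ)⟩ ⟨t, ht, htS⟩
  exact hz2 (interior_subset hz1)

/-- Pairing with a fixed vector. -/
lemma pair_auxM {k n : ℕ} (w : Fin n → Fin k → ℤ) (y : Fin n → ℝ) (l : Fin k → ℝ) :
    ∑ i, auxM w y i * l i = ∑ ν, y ν * ∑ i, (w ν i : ℝ) * l i := by
  simp only [auxM_apply, Finset.sum_apply, Pi.smul_apply, smul_eq_mul, wR, Finset.sum_mul,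
    Finset.mul_sum]
  rw [Finset.sum_comm]
  simp only [mul_assoc]

lemma eff_pos {k n : ℕ} (w : Fin n → Fin k → ℤ) (hproper : IsProperMap (momentMap w))
    (τ : Fin k → ℝ) (hreg : τ ∈ regularValues w) (l : Fin k → ℝ) (hl : l ≠ 0)
    (h : ∀ t ∈ chamber w τ, 0 ≤ ∑ i, t i * l i) : 0 < ∑ i, τ i * l i := by
  have hop : IsOpen (chamber w τ) := (reg_open w hproper).connectedComponentIn
  have hmem : τ ∈ chamber w τ := mem_connectedComponentIn hreg
  have hc : ContinuousAt (fun ε : ℝ => τ - ε • l) 0 := by fun_prop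
  have h1 := hc.eventually (hop.mem_nhds (by simpa using hmem))
  have h2 := ((h1.filter_mono nhdsWithin_le_nhds).and
    (self_mem_nhdsWithin (a := (0 : ℝ)) (s := Set.Ioi 0))).exists
  obtain ⟨ε, h3, h4⟩ := h2
  have h5 := h _ h3
  have h6 : 0 < ∑ i, l i * l i := by
    obtain ⟨i, hi⟩ := Function.ne_iff.1 hl
    exact Finset.sum_pos' (fun i _ => mul_self_nonneg _) ⟨i, Finset.mem_univ i,
      mul_self_pos.2 hi⟩
  have h7 : ∑ i, (τ - ε • l) i * l i = ∑ i, τ i * l i - ε * ∑ i, l i * l i := by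
    simp only [Pi.sub_apply, Pi.smul_apply, smul_eq_mul, sub_mul, Finset.sum_sub_distrib,
      Finset.mul_sum, mul_assoc]
  have := mul_pos (show (0 : ℝ) < ε from h4) h6
  linarith

/-- The optimizer and its dual solution. -/
lemma exists_dual {k n : ℕ} (w : Fin n → Fin k → ℤ) (τ : Fin k → ℝ)
    (hproper : IsProperMap (momentMap w)) (hreg : τ ∈ regularValues w)
    (hne : ∃ x, momentMap w x = τ) (hfree : ActsFreely w τ) (e : Fin n → ℤ) :
    ∃ (y : Fin n → ℝ) (l : Fin k → ℤ), (∀ ν, 0 ≤ y ν) ∧ auxM w y = τ ∧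
      (∀ ν, ∑ i, w ν i * l i ≤ e ν) ∧ (∀ ν, y ν ≠ 0 → ∑ i, w ν i * l i = e ν) := by
  have hK : IsCompact (momentMap w ⁻¹' {τ}) := hproper.isCompact_preimage isCompact_singleton
  obtain ⟨x, hxK, hmin⟩ := hK.exists_isMinOn (f := fun x : Fin n → ℂ =>
    ∑ ν, (π * ‖x ν‖ ^ 2) * (e ν : ℝ)) hne (by fun_prop)
  set y : Fin n → ℝ := fun ν => π * ‖x ν‖ ^ 2 with hydef
  have hy : ∀ ν, 0 ≤ y ν := fun ν => by positivity
  have hyτ : auxM w y = τ := hxK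
  have hs := (reg_iff w τ).1 hreg y hy hyτ
  let F : (Fin n → ℝ) →ₗ[ℝ] ℝ := Fintype.linearCombination ℝ (fun ν => (e ν : ℝ))
  have hF : ∀ v, F v = ∑ ν, v ν * (e ν : ℝ) := fun v => rfl
  have hdir : ∀ v : Fin n → ℝ, auxM w v = 0 → (∀ ν, y ν = 0 → 0 ≤ v ν) → 0 ≤ F v := by
    intro v hv0 hv
    obtain ⟨ε, hε, hpos⟩ := exists_eps y v hy hv
    obtain ⟨x', hx', -⟩ := exists_lift (fun ν => y ν + ε * v ν) hpos
    have hyy : (fun ν => y ν + ε * v ν) = y + ε • v := rfl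
    have h1 : x' ∈ momentMap w ⁻¹' {τ} := by
      rw [Set.mem_preimage, Set.mem_singleton_iff, momentMap_eq, hx', hyy]
      simp [hv0, hyτ]
    have h2 := hmin h1
    have h3 : ∑ ν, (π * ‖x' ν‖ ^ 2) * (e ν : ℝ) = F (y + ε • v) := by
      rw [hF, ← hyy, ← hx']
    have h4 : F y ≤ F (y + ε • v) := by
      rw [← h3]; exact h2
    rw [map_add, map_smul, smul_eq_mul] at h4
    have : 0 ≤ ε * F v := by linarith
    exact nonneg_of_mul_nonneg_right this hε
  choose A hA0 hA using exists_supp w _ hs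
  have hA0' : ∀ t ν, y ν = 0 → A t ν = 0 := fun t ν h => hA0 t ν (by simp [h])
  have hG : ∀ v : Fin n → ℝ, (∀ ν, y ν = 0 → v ν = 0) → ∀ u : Fin n → ℝ,
      (∀ ν, y ν = 0 → u ν = 0) → auxM w v = auxM w u → F v = F u := by
    intro v hv u hu h
    have h1 := hdir (v - u) (by simp [h]) (fun ν h => by simp [hv ν h, hu ν h])
    have h2 := hdir (u - v) (by simp [h]) (fun ν h => by simp [hv ν h, hu ν h])
    rw [map_sub] at h1 h2
    linarith
  let lr : Fin k → ℝ := fun i => F (A (Pi.single i 1))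
  have hl : ∀ t : Fin k → ℝ, F (A t) = ∑ i, t i * lr i := by
    intro t
    have h1 : F (A t) = F (∑ i, t i • A (Pi.single i 1)) := by
      apply hG _ (hA0' t) _ (fun ν h => by simp [hA0' _ ν h])
      rw [map_sum]
      simp only [map_smul, hA]
      exact pi_eq_sum_univ' t
    rw [h1, map_sum]
    simp [lr]
  have hsingle : ∀ ν, auxM w (Pi.single ν 1) = wR w ν := fun ν => by simp [auxM]
  have hFs : ∀ ν, F (Pi.single ν 1) = e ν := fun ν => by simp [F]
  have hle : ∀ ν, ∑ i, (w ν i : ℝ) * lr i ≤ e ν := by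
    intro ν
    have h1 := hdir (Pi.single ν 1 - A (wR w ν)) (by rw [map_sub, hA, hsingle, sub_self])
      (fun μ h => by
        rw [Pi.sub_apply, hA0' _ μ h, sub_zero]
        by_cases hμ : μ = ν
        · subst hμ; simp
        · simp [hμ])
    rw [map_sub, hFs, hl] at h1
    simp only [wR] at h1
    linarith
  have heq : ∀ ν, y ν ≠ 0 → ∑ i, (w ν i : ℝ) * lr i = e ν := by
    intro ν hν
    have h1 := hG (Pi.single ν 1) (fun μ h => by
        have : μ ≠ ν := by rintro rfl; exact hν h
        simp [this]) (A (wR w ν)) (hA0' _) (by rw [hA, hsingle])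
    rw [hFs, hl] at h1
    exact h1.symm
  have hint := hfree x hxK lr (by
    intro ν
    by_cases hx0 : x ν = 0
    · simp [hx0]
    · have hyν : y ν ≠ 0 := by simp [hydef, hx0, pi_ne_zero]
      have h1 : ∑ i, (w ν i : ℂ) * (lr i : ℂ) = (e ν : ℂ) := by
        have := heq ν hyν
        exact_mod_cast congrArg (fun r : ℝ => (r : ℂ)) this
      rw [h1]
      have h2 : Complex.exp (-(2 * (π : ℂ) * Complex.I) * (e ν : ℂ)) = 1 := by
        rw [Complex.exp_eq_one_iff]
        exact ⟨-e ν, by push_cast; ring⟩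
      rw [h2, one_mul])
  choose l hlr using hint
  refine ⟨y, l, hy, hyτ, fun ν => ?_, fun ν hν => ?_⟩
  · have := hle ν
    simp only [hlr] at this
    exact_mod_cast this
  · have := heq ν hν
    simp only [hlr] at this
    exact_mod_cast this

/-- Batyrev's generators: under the standing assumptions the
ideal `ℐ_τ` is generated by the linear relations, the variables `u_ν` with
`τ ∉ C({1,…,n}∖{ν})`, and the monomials `u^{d⁺}` for `d ∈ D_eff(τ) \ {0}`. -/
theorem idealI_eq_batyrev_ideal
    (k n : ℕ) (hk : 1 ≤ k) (hkn : k ≤ n)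
    (w : Fin n → Fin k → ℤ)
    (hspan : Submodule.span ℝ (Set.range (wR w)) = ⊤)
    (τ : Fin k → ℝ)
    (hproper : IsProperMap (momentMap w))
    (hreg : τ ∈ regularValues w)
    (hne : ∃ x, momentMap w x = τ)
    (hfree : ActsFreely w τ) :
    idealI w τ =
      Ideal.span
        ({p | ∃ η : Fin n → ℝ, (∑ ν, η ν • wR w ν = 0) ∧
            p = ∑ ν, MvPolynomial.C (η ν) * MvPolynomial.X ν} ∪
          {p | ∃ ν : Fin n, τ ∉ cone w ({ν}ᶜ) ∧ p = MvPolynomial.X ν} ∪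
          {p | ∃ d : Fin n → ℤ, d ≠ 0 ∧
            (∃ l ∈ LambdaEff w τ, ∀ ν, d ν = ∑ i, w ν i * l i) ∧
            p = ∏ ν, MvPolynomial.X ν ^ (d ν).toNat}) := by
  classical
  apply le_antisymm
  · unfold idealI
    rw [Ideal.span_le]
    rintro p (hp | ⟨I, hI, rfl⟩)
    · exact Ideal.subset_span (Or.inl (Or.inl hp))
    by_cases hb : ∃ ν ∈ I, τ ∉ cone w ({ν}ᶜ)
    · obtain ⟨ν, hν, hν2⟩ := hb
      exact Ideal.mem_of_dvd _ (Finset.dvd_prod_of_mem _ hν)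
        (Ideal.subset_span (Or.inl (Or.inr ⟨ν, hν2, rfl⟩)))
    push Not at hb
    obtain ⟨y, l, hy, hyτ, hle, heq⟩ := exists_dual w τ hproper hreg hne hfree
      (fun ν => if ν ∈ I then 1 else 0)
    have hyI : ∃ ν ∈ I, y ν ≠ 0 := by
      by_contra hcon
      push Not at hcon
      exact hI ((mem_cone_iff w _ _).2 ⟨y, hy, fun ν h => hcon ν (by simpa using h), hyτ⟩)
    have hdvd : (∏ ν, (MvPolynomial.X ν : MvPolynomial (Fin n) ℝ) ^
        (∑ i, w ν i * l i).toNat) ∣ ∏ ν ∈ I, MvPolynomial.X ν := by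
      have : (∏ ν ∈ I, MvPolynomial.X ν : MvPolynomial (Fin n) ℝ) =
          ∏ ν, MvPolynomial.X ν ^ (if ν ∈ I then 1 else 0) := by
        simp [Finset.prod_ite_mem, pow_ite]
      rw [this]
      refine Finset.prod_dvd_prod_of_dvd _ _ fun ν _ => pow_dvd_pow _ ?_
      have := hle ν
      split_ifs at this ⊢ <;> omega
    refine Ideal.mem_of_dvd _ hdvd (Ideal.subset_span (Or.inr
      ⟨fun ν => ∑ i, w ν i * l i, ?_, ⟨l, ⟨?_, ?_⟩, fun ν => rfl⟩, rfl⟩))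
    · obtain ⟨ν, hν, hν2⟩ := hyI
      intro h0
      have h1 := congrFun h0 ν
      have h2 := heq ν hν2
      simp only [hν, if_true, Pi.zero_apply] at h1 h2
      omega
    · intro ν hν
      have hyν : y ν ≠ 0 := by
        intro h0
        refine hν ((mem_cone_iff w _ _).2 ⟨y, hy, fun μ h => ?_, hyτ⟩)
        have : μ = ν := by simpa using h
        rw [this, h0]
      rw [heq ν hyν, if_neg (fun h => hν (hb ν h))]
    · intro t ht
      have hS : τ ∈ cone w (Finset.univ.filter fun ν => y ν ≠ 0) :=
        (mem_cone_iff w _ _).2 ⟨y, hy, by simp, hyτ⟩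
      obtain ⟨z, hz, hzS, rfl⟩ := (mem_cone_iff w _ _).1
        (chamber_subset_cone w hproper τ _ hS hreg ht)
      rw [pair_auxM]
      refine Finset.sum_nonneg fun ν _ => ?_
      by_cases h0 : y ν = 0
      · rw [hzS ν (by simp [h0]), zero_mul]
      · have h1 := heq ν h0
        have h2 : ∑ i, (w ν i : ℝ) * (l i : ℝ) = ((if ν ∈ I then 1 else 0 : ℤ) : ℝ) := by
          exact_mod_cast congrArg (fun r : ℤ => (r : ℝ)) h1
        rw [h2]
        refine mul_nonneg (hz ν) ?_
        split_ifs <;> simp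
  · rw [Ideal.span_le]
    rintro p ((hp | ⟨ν, hν, rfl⟩) | ⟨d, hd, ⟨l, ⟨-, hl⟩, hdl⟩, rfl⟩)
    · exact Ideal.subset_span (Or.inl hp)
    · exact Ideal.subset_span (Or.inr ⟨{ν}, hν, by simp⟩)
    · have hdvd : (∏ ν ∈ Finset.univ.filter (fun ν => 0 < d ν),
          (MvPolynomial.X ν : MvPolynomial (Fin n) ℝ)) ∣
          ∏ ν, MvPolynomial.X ν ^ (d ν).toNat := by
        rw [Finset.prod_filter]
        refine Finset.prod_dvd_prod_of_dvd _ _ fun ν _ => ?_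
        split_ifs with h
        · exact dvd_pow_self _ (by omega)
        · exact one_dvd _
      refine Ideal.mem_of_dvd _ hdvd (Ideal.subset_span (Or.inr ⟨_, ?_, rfl⟩))
      intro hc
      obtain ⟨y, hy, hyS, hyτ⟩ := (mem_cone_iff w _ _).1 hc
      have hl0 : (fun i => (l i : ℝ)) ≠ 0 := by
        intro h0
        apply hd
        funext ν
        rw [hdl]
        refine Finset.sum_eq_zero fun i _ => ?_
        have : (l i : ℝ) = 0 := congrFun h0 i
        have : l i = 0 := by exact_mod_cast this
        simp [this]
      have hpos := eff_pos w hproper τ hreg _ hl0 hl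
      rw [← hyτ, pair_auxM] at hpos
      refine absurd hpos (not_lt.2 (Finset.sum_nonpos fun ν _ => ?_))
      have h1 : ∑ i, (w ν i : ℝ) * (l i : ℝ) = (d ν : ℝ) := by
        rw [hdl]; push_cast; rfl
      rw [h1]
      by_cases h : 0 < d ν
      · rw [hyS ν (by simp [h]), zero_mul]
      · have : (d ν : ℝ) ≤ 0 := by exact_mod_cast not_lt.1 h
        exact mul_nonpos_of_nonneg_of_nonpos (hy ν) this
end
end

section
/- Let τ ∈ (ℝ^k)* be a regular value of μ. If λ ∈ ℤ^k satisfies ⟨τ, λ⟩ > 0 and d_ν := ⟨w_ν, λ⟩ for ν = 1,…,n, then the monomial u^{d⁺} = ∏_{ν=1}^n u_ν^{max{d_ν,0}} belongs to the ideal ℐ_τ. -/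
open Real Finset

noncomputable section

/-- if `λ ∈ ℤ^k` satisfies `⟨τ, λ⟩ > 0` and `d_ν = ⟨w_ν, λ⟩`, then
the monomial `u^{d⁺}` belongs to the ideal `ℐ_τ`. -/
theorem monomial_dplus_mem_idealI
    (k n : ℕ) (hk : 1 ≤ k) (hkn : k ≤ n)
    (w : Fin n → Fin k → ℤ)
    (hspan : Submodule.span ℝ (Set.range (wR w)) = ⊤)
    (τ : Fin k → ℝ) (hreg : IsRegularValue w τ)
    (l : Fin k → ℤ) (hpos : 0 < ∑ i, τ i * (l i : ℝ))
    (d : Fin n → ℤ) (hd : ∀ ν, d ν = ∑ i, w ν i * l i) :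
    (∏ ν, MvPolynomial.X ν ^ (d ν).toNat) ∈ idealI w τ := by
  have hI : τ ∉ cone w (Finset.univ.filter (fun ν => 0 < d ν))ᶜ := by
    rintro ⟨c, hc, rfl⟩
    refine absurd hpos (not_lt.mpr ?_)
    have : ∑ i, (∑ ν ∈ (Finset.univ.filter (fun ν => 0 < d ν))ᶜ, c ν • wR w ν) i * (l i : ℝ)
        = ∑ ν ∈ (Finset.univ.filter (fun ν => 0 < d ν))ᶜ, c ν * (d ν : ℝ) := by
      simp only [Finset.sum_apply, Finset.sum_mul, Pi.smul_apply, smul_eq_mul, wR]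
      rw [Finset.sum_comm]
      refine Finset.sum_congr rfl fun ν _ => ?_
      rw [hd ν]
      push_cast
      rw [Finset.mul_sum]
      exact Finset.sum_congr rfl fun i _ => by ring
    rw [this]
    refine Finset.sum_nonpos fun ν hν => ?_
    have h0 : d ν ≤ 0 := by simpa using hν
    exact mul_nonpos_of_nonneg_of_nonpos (hc ν) (by exact_mod_cast h0)
  refine Ideal.mem_of_dvd _ ?_ (Ideal.subset_span (Or.inr ⟨_, hI, rfl⟩))
  rw [Finset.prod_filter]
  refine Finset.prod_dvd_prod_of_dvd _ _ fun ν _ => ?_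
  split_ifs with h
  · exact dvd_pow_self _ (by omega)
  · exact one_dvd _
end
end

section
/- Let λ ∈ ℤ^k, d_ν := ⟨w_ν, λ⟩, let J ⊆ {1,…,n} with |J| = k be such that {w_ν : ν ∈ J} is a basis of (ℝ^k)*, and let ℓ be an n-tuple of nonnegative integers with ℓ_ν = d_ν for every ν ∈ J and ℓ_ν = d_ν + 1 for every ν ∉ J. Then for every enumeration J = {ν_1, …, ν_k} (i.e., every bijection j ↦ ν_j from {1,…,k} onto J) there exists exactly one ordered partition I = (I_1,…,I_k) ∈ ℐ_λ(ℓ) with ν_j ∈ I_j for every j = 1,…,k. -/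
open Real Finset

noncomputable section

/-- `I = (I_1,…,I_k)` is an ordered partition of `{1,…,n}`. -/
def IsOrderedPartition {k n : ℕ} (I : Fin k → Finset (Fin n)) : Prop :=
  (∀ i j : Fin k, i ≠ j → Disjoint (I i) (I j)) ∧
    Finset.univ.biUnion I = Finset.univ

/-- The partition `I` belongs to the set `ℐ` (the (Dimension) condition). -/
def MemCalI {k n : ℕ} (w : Fin n → Fin k → ℤ) (I : Fin k → Finset (Fin n)) : Prop :=
  IsOrderedPartition I ∧
    ∀ j : Fin k,
      Module.finrank ℝ
          ↥(Submodule.span ℝ (wR w '' {ν | ∃ i ≤ j, ν ∈ I i})) = (j : ℕ) + 1 ∧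
        ∀ ν : Fin n, (∃ i, j < i ∧ ν ∈ I i) →
          wR w ν ∉ Submodule.span ℝ (wR w '' {ν' | ∃ i ≤ j, ν' ∈ I i})

/-- The partition `I` belongs to `ℐ_λ(ℓ)` (the (Dimension) and (Degree)
conditions), where `d_ν = ⟨w_ν, λ⟩ = ∑ i, w ν i * l i`. -/
def MemCalIlambda {k n : ℕ} (w : Fin n → Fin k → ℤ) (l : Fin k → ℤ)
    (ℓ : Fin n → ℕ) (I : Fin k → Finset (Fin n)) : Prop :=
  MemCalI w I ∧
    ∀ j : Fin k, ∑ ν ∈ I j, ((ℓ ν : ℤ) - (∑ i, w ν i * l i) - 1) = -1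

/-- for exponents `ℓ` adapted to a basis subset `J`, every
enumeration `J = {ν_1,…,ν_k}` determines a unique partition `I ∈ ℐ_λ(ℓ)` with
`ν_j ∈ I_j` for every `j`. -/
theorem existsUnique_memCalIlambda_of_enumeration
    (k n : ℕ) (hk : 1 ≤ k) (hkn : k ≤ n)
    (w : Fin n → Fin k → ℤ)
    (hspan : Submodule.span ℝ (Set.range (wR w)) = ⊤)
    (l : Fin k → ℤ)
    (J : Finset (Fin n)) (hJcard : J.card = k)
    (hJindep : LinearIndependent ℝ (fun j : {ν // ν ∈ J} => wR w j.1))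
    (hJspan : Submodule.span ℝ (wR w '' ↑J) = ⊤)
    (ℓ : Fin n → ℕ)
    (hℓJ : ∀ ν ∈ J, (ℓ ν : ℤ) = ∑ i, w ν i * l i)
    (hℓJc : ∀ ν ∉ J, (ℓ ν : ℤ) = (∑ i, w ν i * l i) + 1)
    (e : Fin k → Fin n) (he : Function.Injective e)
    (hrange : ∀ ν, ν ∈ J ↔ ν ∈ Set.range e) :
    ∃! I : Fin k → Finset (Fin n),
      MemCalIlambda w l ℓ I ∧ ∀ j : Fin k, e j ∈ I j := by
  classical
  have hli : LinearIndependent ℝ (fun j : Fin k => wR w (e j)) := by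
    have h := hJindep.comp (fun j : Fin k => (⟨e j, (hrange _).2 ⟨j, rfl⟩⟩ : {ν // ν ∈ J}))
      (fun a b hab => he (by simpa using hab))
    exact h
  obtain ⟨F, hF⟩ : ∃ F : Fin k → Submodule ℝ (Fin k → ℝ),
      ∀ j, F j = Submodule.span ℝ ((fun i : Fin k => wR w (e i)) '' Set.Iic j) := ⟨_, fun _ => rfl⟩
  have hmono : ∀ i j, i ≤ j → F i ≤ F j := by
    intro i j hij
    rw [hF, hF]
    exact Submodule.span_mono (Set.image_mono (Set.Iic_subset_Iic.2 hij))
  have hmem : ∀ i j, i ≤ j → wR w (e i) ∈ F j := by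
    intro i j hij
    rw [hF]
    exact Submodule.subset_span ⟨i, hij, rfl⟩
  have hnot : ∀ i j, j < i → wR w (e i) ∉ F j := by
    intro i j hij
    rw [hF]
    exact hli.notMem_span_image (by simpa using hij)
  have hrank : ∀ j, Module.finrank ℝ (F j) = (j : ℕ) + 1 := by
    intro j
    have h := finrank_span_eq_card (hli.comp (fun i : Set.Iic j => (i : Fin k))
      Subtype.val_injective)
    have h2 : Set.range ((fun j : Fin k => wR w (e j)) ∘ (fun i : Set.Iic j => (i : Fin k)))
        = (fun i : Fin k => wR w (e i)) '' Set.Iic j := by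
      rw [Set.range_comp, Subtype.range_coe]
    rw [h2, ← hF] at h
    rw [h]
    simp
  have htop : ∀ x, ∃ j, x ∈ F j := by
    intro x
    refine ⟨⟨k - 1, by omega⟩, ?_⟩
    have : F ⟨k - 1, by omega⟩ = ⊤ := by
      apply Submodule.eq_top_of_finrank_eq
      rw [hrank]
      simp
      omega
    rw [this]; trivial
  obtain ⟨I, hI⟩ : ∃ I : Fin k → Finset (Fin n),
      ∀ j ν, ν ∈ I j ↔ wR w ν ∈ F j ∧ ∀ i < j, wR w ν ∉ F i :=
    ⟨fun j => Finset.univ.filter (fun ν => wR w ν ∈ F j ∧ ∀ i < j, wR w ν ∉ F i), by simp⟩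
  have huniq : ∀ i j ν, ν ∈ I i → ν ∈ I j → i = j := by
    intro i j ν hi hj
    rw [hI] at hi hj
    rcases lt_trichotomy i j with h | h | h
    · exact absurd hi.1 (hj.2 i h)
    · exact h
    · exact absurd hj.1 (hi.2 j h)
  have heI : ∀ j, e j ∈ I j := fun j =>
    (hI _ _).2 ⟨hmem j j le_rfl, fun i hi => hnot j i hi⟩
  have hE : ∀ j, Submodule.span ℝ (wR w '' {ν | ∃ i ≤ j, ν ∈ I i}) = F j := by
    intro j
    apply le_antisymm
    · rw [Submodule.span_le]
      rintro _ ⟨ν, ⟨i, hij, hν⟩, rfl⟩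
      exact hmono i j hij ((hI _ _).1 hν).1
    · rw [hF]
      apply Submodule.span_mono
      rintro _ ⟨i, hij, rfl⟩
      exact ⟨e i, ⟨i, hij, heI i⟩, rfl⟩
  refine ⟨I, ⟨⟨⟨⟨?_, ?_⟩, ?_⟩, ?_⟩, heI⟩, ?_⟩
  · intro i j hij
    rw [Finset.disjoint_left]
    intro ν hi hj
    exact hij (huniq i j ν hi hj)
  · ext ν
    simp only [Finset.mem_biUnion, Finset.mem_univ, true_and, iff_true]
    obtain ⟨j, hj, hmin⟩ := WellFounded.has_min (wellFounded_lt (α := Fin k))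
      {j | wR w ν ∈ F j} (htop _)
    exact ⟨j, (hI _ _).2 ⟨hj, fun i hi hm => hmin i hm hi⟩⟩
  · intro j
    rw [hE]
    refine ⟨hrank j, ?_⟩
    rintro ν ⟨i, hji, hν⟩
    exact ((hI _ _).1 hν).2 j hji
  · intro j
    rw [Finset.sum_eq_single_of_mem (e j) (heI j)]
    · rw [hℓJ _ ((hrange _).2 ⟨j, rfl⟩)]; ring
    · intro ν hν hne
      rw [hℓJc]
      · ring
      · intro hJ
        obtain ⟨i, rfl⟩ := (hrange _).1 hJ
        exact hne (by rw [huniq i j _ (heI i) hν])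
  · rintro I' ⟨⟨⟨⟨hdis, hcov⟩, hdim⟩, -⟩, heI'⟩
    have hE' : ∀ j, F j = Submodule.span ℝ (wR w '' {ν | ∃ i ≤ j, ν ∈ I' i}) := by
      intro j
      apply Submodule.eq_of_le_of_finrank_eq
      · rw [hF]
        apply Submodule.span_mono
        rintro _ ⟨i, hij, rfl⟩
        exact ⟨e i, ⟨i, hij, heI' i⟩, rfl⟩
      · rw [hrank, (hdim j).1]
    have hsub : ∀ j ν, ν ∈ I' j → ν ∈ I j := by
      intro j ν hν
      rw [hI]
      constructor
      · rw [hE']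
        exact Submodule.subset_span ⟨ν, ⟨j, le_rfl, hν⟩, rfl⟩
      · intro i hi
        rw [hE']
        exact (hdim i).2 ν ⟨j, hi, hν⟩
    funext j
    ext ν
    refine ⟨hsub j ν, fun hν => ?_⟩
    have : ν ∈ Finset.univ.biUnion I' := by rw [hcov]; simp
    obtain ⟨i, -, hi⟩ := Finset.mem_biUnion.1 this
    rwa [huniq j i ν hν (hsub i ν hi)]
end
end

section
/- Let τ ∈ (ℝ^k)* be a regular value of μ, let λ ∈ Λ_eff(τ) with λ ≠ 0, and let τ' ∈ Ch(τ). Then ⟨τ', λ⟩ > 0. -/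
open Real Finset

noncomputable section

lemma cone_caratheodory {k n : ℕ} (w : Fin n → Fin k → ℤ) (S : Finset (Fin n))
    (g : Fin n → ℝ) (hg : ∑ ν ∈ S, g ν • wR w ν = 0) (hpos : ∃ ν ∈ S, 0 < g ν)
    (t : Fin k → ℝ) (ht : t ∈ cone w S) : ∃ ν ∈ S, t ∈ cone w (S.erase ν) := by
  classical
  obtain ⟨c, hc, rfl⟩ := ht
  obtain ⟨ν₀, hν₀, hmin⟩ := (S.filter (fun ν => 0 < g ν)).exists_min_image
    (fun ν => c ν / g ν) (by
      obtain ⟨ν, h1, h2⟩ := hpos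
      exact ⟨ν, by simp [h1, h2]⟩)
  simp only [Finset.mem_filter] at hν₀ hmin
  obtain ⟨hS, hg0⟩ := hν₀
  have hr : 0 ≤ c ν₀ / g ν₀ := div_nonneg (hc _) hg0.le
  refine ⟨ν₀, hS, fun ν => if ν ∈ S then c ν - c ν₀ / g ν₀ * g ν else 0, ?_, ?_⟩
  · intro ν
    by_cases h : ν ∈ S
    · simp only [h, if_true]
      rcases lt_or_ge 0 (g ν) with h' | h'
      · have := hmin ν ⟨h, h'⟩
        rw [le_div_iff₀ h'] at this
        linarith
      · have := mul_nonpos_of_nonneg_of_nonpos hr h'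
        linarith [hc ν]
    · simp [h]
  · have h1 : ∑ ν ∈ S, (c ν - c ν₀ / g ν₀ * g ν) • wR w ν = ∑ ν ∈ S, c ν • wR w ν := by
      simp only [sub_smul, mul_smul, Finset.sum_sub_distrib, ← Finset.smul_sum, hg, smul_zero,
        sub_zero]
    rw [← h1, ← Finset.add_sum_erase S _ hS, div_mul_cancel₀ _ hg0.ne', sub_self, zero_smul,
      zero_add]
    refine Finset.sum_congr rfl fun ν hν => ?_
    simp [Finset.mem_of_mem_erase hν]

lemma cone_mono {k n : ℕ} (w : Fin n → Fin k → ℤ) {S T : Finset (Fin n)} (h : S ⊆ T) :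
    cone w S ⊆ cone w T := by
  classical
  rintro t ⟨c, hc, rfl⟩
  refine ⟨fun ν => if ν ∈ S then c ν else 0, fun ν => by
    by_cases h : ν ∈ S <;> simp [h, hc], ?_⟩
  rw [← Finset.sum_subset h]
  · exact Finset.sum_congr rfl fun ν hν => by simp [hν]
  · intro ν _ hν
    simp [hν]

lemma cone_isClosed {k n : ℕ} (w : Fin n → Fin k → ℤ) (S : Finset (Fin n)) :
    IsClosed (cone w S) := by
  classical
  induction S using Finset.strongInduction with
  | H S ih =>
  by_cases hli : LinearIndependent ℝ (fun ν : S => wR w ν)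
  · have hinj : Function.Injective (Fintype.linearCombination ℝ (fun ν : S => wR w ν)) :=
      hli.fintypeLinearCombination_injective
    have hce := LinearMap.isClosedEmbedding_of_injective (LinearMap.ker_eq_bot.2 hinj)
    have hO : IsClosed {c : S → ℝ | ∀ ν, 0 ≤ c ν} := by
      simp only [Set.setOf_forall]
      exact isClosed_iInter fun ν => isClosed_le continuous_const (continuous_apply ν)
    convert hce.isClosedMap _ hO using 1
    ext t
    constructor
    · rintro ⟨c, hc, rfl⟩
      refine ⟨fun ν => c ν, fun ν => hc ν, ?_⟩
      rw [Fintype.linearCombination_apply]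
      exact Finset.sum_coe_sort S (fun ν => c ν • wR w ν)
    · rintro ⟨c, hc, rfl⟩
      refine ⟨fun ν => if h : ν ∈ S then c ⟨ν, h⟩ else 0, fun ν => ?_, ?_⟩
      · by_cases h : ν ∈ S
        · simpa [h] using hc ⟨ν, h⟩
        · simp [h]
      · rw [Fintype.linearCombination_apply, ← Finset.sum_coe_sort S]
        exact Finset.sum_congr rfl fun ν _ => by simp
  · rw [Fintype.not_linearIndependent_iff] at hli
    obtain ⟨g, hg, ν, hν⟩ := hli
    have key : ∃ g : Fin n → ℝ, ∑ ν ∈ S, g ν • wR w ν = 0 ∧ ∃ ν ∈ S, 0 < g ν := by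
      have h0 : ∑ ν ∈ S, (if h : ν ∈ S then g ⟨ν, h⟩ else 0) • wR w ν = 0 := by
        rw [← hg, ← Finset.sum_coe_sort S]
        exact Finset.sum_congr rfl fun ν _ => by simp
      rcases lt_or_gt_of_ne hν with h | h
      · refine ⟨fun ν => - (if h : ν ∈ S then g ⟨ν, h⟩ else 0), ?_, ν, ν.2, by simpa using h⟩
        simp only [neg_smul, Finset.sum_neg_distrib, h0, neg_zero]
      · exact ⟨_, h0, ν, ν.2, by simpa using h⟩
    obtain ⟨g, hg, hpos⟩ := key
    have : cone w S = ⋃ ν ∈ S, cone w (S.erase ν) := by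
      ext t
      simp only [Set.mem_iUnion, exists_prop]
      exact ⟨cone_caratheodory w S g hg hpos t, fun ⟨ν, _, h⟩ =>
        cone_mono w (Finset.erase_subset _ _) h⟩
    rw [this]
    exact Set.Finite.isClosed_biUnion S.finite_toSet
      fun ν hν => ih _ (Finset.erase_ssubset hν)

lemma regularValues_isOpen {k n : ℕ} (w : Fin n → Fin k → ℤ) : IsOpen (regularValues w) := by
  classical
  rw [← isClosed_compl_iff]
  have : (regularValues w)ᶜ =
      ⋃ S ∈ {S : Finset (Fin n) | Submodule.span ℝ (wR w '' (S : Set (Fin n))) ≠ ⊤}, cone w S := by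
    ext t
    simp only [regularValues, Set.mem_compl_iff, Set.mem_ofPred_eq, not_forall, Set.mem_iUnion,
      exists_prop]
    constructor
    · rintro ⟨x, rfl, hx⟩
      refine ⟨Finset.univ.filter (fun ν => x ν ≠ 0), by simpa using hx,
        fun ν => π * ‖x ν‖ ^ 2, fun ν => by positivity, ?_⟩
      rw [momentMap, Finset.sum_filter]
      refine Finset.sum_congr rfl fun ν _ => ?_
      by_cases h : x ν = 0 <;> simp [h]
    · rintro ⟨S, hS, c, hc, rfl⟩
      refine ⟨fun ν => if ν ∈ S then ((√(c ν / π) : ℝ) : ℂ) else 0, ?_, fun h => hS ?_⟩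
      · rw [momentMap, ← Finset.sum_subset (Finset.subset_univ S)]
        · refine Finset.sum_congr rfl fun ν hν => ?_
          have : 0 ≤ c ν / π := div_nonneg (hc ν) pi_pos.le
          simp only [hν, if_true, Complex.norm_real, Real.norm_eq_abs, sq_abs, Real.sq_sqrt this]
          rw [mul_div_cancel₀ _ pi_pos.ne']
        · intro ν _ hν
          simp [hν]
      · rw [eq_top_iff, ← h]
        refine Submodule.span_mono (Set.image_mono fun ν hν => ?_)
        by_contra h'
        exact hν (if_neg h')
  rw [this]
  exact Set.Finite.isClosed_biUnion (Set.toFinite _) fun S _ => cone_isClosed w S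

/-- for a nonzero `λ ∈ Λ_eff(τ)` and any `τ'` in the chamber of a
regular value `τ`, one has `⟨τ', λ⟩ > 0`. -/
theorem pairing_pos_of_nonzero_effective
    (k n : ℕ) (hk : 1 ≤ k) (hkn : k ≤ n)
    (w : Fin n → Fin k → ℤ)
    (hspan : Submodule.span ℝ (Set.range (wR w)) = ⊤)
    (τ : Fin k → ℝ) (hreg : τ ∈ regularValues w)
    (l : Fin k → ℤ) (hl : l ∈ LambdaEff w τ) (hlne : l ≠ 0)
    (τ' : Fin k → ℝ) (hτ' : τ' ∈ chamber w τ) :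
    0 < ∑ i, τ' i * (l i : ℝ) := by
  have hopen : IsOpen (chamber w τ) := (regularValues_isOpen w).connectedComponentIn
  have hcont : Continuous (fun e : ℝ => fun i => τ' i - e * (l i : ℝ)) := by fun_prop
  have hnhds := (hopen.preimage hcont).mem_nhds (x := 0) (by simpa using hτ')
  obtain ⟨ε, hε, hball⟩ := Metric.mem_nhds_iff.1 hnhds
  have hm : ε / 2 ∈ Metric.ball (0 : ℝ) ε := by
    rw [Metric.mem_ball, dist_zero_right, Real.norm_eq_abs, abs_of_pos (by positivity)]
    linarith
  have h := hl.2 _ (hball hm)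
  have hpos : 0 < ∑ i, (l i : ℝ) * (l i : ℝ) := by
    obtain ⟨i, hi⟩ := Function.ne_iff.1 hlne
    have hi' : (l i : ℝ) ≠ 0 := by exact_mod_cast hi
    exact Finset.sum_pos' (fun j _ => mul_self_nonneg _) ⟨i, Finset.mem_univ _, mul_self_pos.2 hi'⟩
  simp only [sub_mul, Finset.sum_sub_distrib, mul_assoc, ← Finset.mul_sum] at h
  have := mul_pos (half_pos hε) hpos
  linarith
end
end
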